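/- Let n, k ≥ 1 be integers and let M ≥ 0 be an integer. Suppose that for every set V ⊆ ℝ² of n distinct points and every point x ∉ V, every finite family of pairwise non-homotopic x-loops in which each loop has fewer than k self-intersections and every two distinct loops have fewer than k intersections has at most M members. Then for every set V' ⊆ ℝ² of n distinct points and every v ∈ V', every finite family of pairwise non-homotopic v-loops in which each loop has fewer than k self-intersections and every two distinct loops have fewer than k intersections has at most M members. (In the notation of the paper: g(n,k) ≤ f(n,k).) -/

import Mathlib

/-- An `x`-loop with respect to the obstacle set `V`: a continuous function on `[0,1]`
with both endpoints at `x`, avoiding `V` on the open interval `(0,1)`. -/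
def IsLoop (V : Set (ℝ × ℝ)) (x : ℝ × ℝ) (f : ℝ → ℝ × ℝ) : Prop :=
  ContinuousOn f (Set.Icc 0 1) ∧ f 0 = x ∧ f 1 = x ∧ ∀ t ∈ Set.Ioo (0:ℝ) 1, f t ∉ V

/-- Two `x`-loops are homotopic (relative to the obstacle set `V`). -/
def LoopHomotopic (V : Set (ℝ × ℝ)) (x : ℝ × ℝ) (f g : ℝ → ℝ × ℝ) : Prop :=
  ∃ H : ℝ → ℝ → ℝ × ℝ,
    ContinuousOn (fun p : ℝ × ℝ => H p.1 p.2) (Set.Icc 0 1 ×ˢ Set.Icc 0 1) ∧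
    (∀ t ∈ Set.Icc (0:ℝ) 1, H 0 t = f t ∧ H 1 t = g t) ∧
    (∀ s ∈ Set.Icc (0:ℝ) 1, H s 0 = x ∧ H s 1 = x) ∧
    (∀ s ∈ Set.Ioo (0:ℝ) 1, ∀ t ∈ Set.Ioo (0:ℝ) 1, H s t ∉ V)

/-- The set of self-intersections of a loop: unordered pairs `{t,u} ⊆ (0,1)`, `t ≠ u`,
`f t = f u`, encoded as ordered pairs with `t < u`. -/
def SelfIntersections (f : ℝ → ℝ × ℝ) : Set (ℝ × ℝ) :=
  {p | p.1 ∈ Set.Ioo (0:ℝ) 1 ∧ p.2 ∈ Set.Ioo (0:ℝ) 1 ∧ p.1 < p.2 ∧ f p.1 = f p.2}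

/-- The set of intersections of two loops: ordered pairs `(t,u) ∈ (0,1)²` with
`f t = g u`. -/
def Intersections (f g : ℝ → ℝ × ℝ) : Set (ℝ × ℝ) :=
  {p | p.1 ∈ Set.Ioo (0:ℝ) 1 ∧ p.2 ∈ Set.Ioo (0:ℝ) 1 ∧ f p.1 = g p.2}

/-- Loop `f` has fewer than `k` self-intersections. -/
def FewerSelfInterThan (k : ℕ) (f : ℝ → ℝ × ℝ) : Prop :=
  (SelfIntersections f).Finite ∧ (SelfIntersections f).ncard < k

/-- Loops `f` and `g` have fewer than `k` intersections. -/
def FewerInterThan (k : ℕ) (f g : ℝ → ℝ × ℝ) : Prop :=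
  (Intersections f g).Finite ∧ (Intersections f g).ncard < k

/-- A continuous curve in the plane with finitely many self-intersections is nowhere dense: its
complement is dense. -/
theorem dense_compl_image_Icc {f : ℝ → ℝ × ℝ} (hf : ContinuousOn f (Set.Icc 0 1))
    (hfin : (SelfIntersections f).Finite) : Dense (f '' Set.Icc 0 1)ᶜ := by
  rw [← interior_eq_empty_iff_dense_compl]
  by_contra hne
  obtain ⟨p, hp⟩ := Set.nonempty_iff_ne_empty.2 hne
  set B : Set (ℝ × ℝ) := {f 0, f 1} ∪ (fun q : ℝ × ℝ => f q.1) '' SelfIntersections f with hB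
  have hBfin : B.Finite := (Set.toFinite _).union (hfin.image _)
  have hinj : ∀ t ∈ Set.Icc (0:ℝ) 1, ∀ u ∈ Set.Icc (0:ℝ) 1, f t ∉ B → f t = f u → t = u := by
    have key : ∀ t ∈ Set.Icc (0:ℝ) 1, f t ∉ B → t ∈ Set.Ioo (0:ℝ) 1 := by
      intro t ht htB
      refine ⟨lt_of_le_of_ne ht.1 ?_, lt_of_le_of_ne ht.2 ?_⟩
      · rintro rfl
        simp [hB] at htB
      · rintro rfl
        simp [hB] at htB
    intro t ht u hu htB h
    have ht' := key t ht htB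
    have hu' := key u hu (h ▸ htB)
    rcases lt_trichotomy t u with hlt | heq | hlt
    · exact absurd (Or.inr ⟨(t, u), ⟨ht', hu', hlt, h⟩, rfl⟩) htB
    · exact heq
    · exact absurd (Or.inr ⟨(u, t), ⟨hu', ht', hlt, h.symm⟩, h.symm⟩) htB
  have hopen : IsOpen (interior (f '' Set.Icc 0 1) \ B) :=
    isOpen_interior.sdiff hBfin.isClosed
  obtain ⟨q, hq⟩ : (interior (f '' Set.Icc 0 1) \ B).Nonempty :=
    ((infinite_of_mem_nhds p (isOpen_interior.mem_nhds hp)).sdiff hBfin).nonempty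
  obtain ⟨r, hr, hball⟩ := Metric.isOpen_iff.1 hopen q hq
  set γ : ℝ → ℝ × ℝ := fun θ => q + (r / 2 * Real.cos θ, r / 2 * Real.sin θ) with hγ
  have hγc : Continuous γ := by fun_prop
  have hγmem : ∀ θ, γ θ ∈ interior (f '' Set.Icc 0 1) \ B := by
    intro θ
    apply hball
    have h1 : |r / 2 * Real.cos θ| < r := by
      rw [abs_mul, abs_of_pos (half_pos hr)]
      nlinarith [Real.abs_cos_le_one θ]
    have h2 : |r / 2 * Real.sin θ| < r := by
      rw [abs_mul, abs_of_pos (half_pos hr)]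
      nlinarith [Real.abs_sin_le_one θ]
    rw [Metric.mem_ball, hγ, dist_eq_norm, add_sub_cancel_left, Prod.norm_def]
    exact max_lt h1 h2
  have hex : ∀ z : ℝ × ℝ, ∃ t, z ∈ f '' Set.Icc 0 1 → t ∈ Set.Icc (0:ℝ) 1 ∧ f t = z := by
    intro z
    by_cases hz : z ∈ f '' Set.Icc 0 1
    · obtain ⟨t, ht⟩ := hz
      exact ⟨t, fun _ => ht⟩
    · exact ⟨0, fun h => absurd h hz⟩
  choose σ hσ using hex
  have hσγ : ∀ θ, σ (γ θ) ∈ Set.Icc (0:ℝ) 1 ∧ f (σ (γ θ)) = γ θ := fun θ =>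
    hσ _ (interior_subset (hγmem θ).1)
  have hτc : Continuous fun θ => σ (γ θ) := by
    rw [continuous_iff_isClosed]
    intro C hC
    have : (fun θ => σ (γ θ)) ⁻¹' C = γ ⁻¹' (f '' (Set.Icc 0 1 ∩ C)) := by
      ext θ
      constructor
      · intro h
        exact ⟨σ (γ θ), ⟨(hσγ θ).1, h⟩, (hσγ θ).2⟩
      · rintro ⟨t, ⟨ht, htC⟩, hft⟩
        have := hinj t ht _ (hσγ θ).1 (hft ▸ (hγmem θ).2) (hft.trans (hσγ θ).2.symm)
        rw [Set.mem_preimage, ← this]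
        exact htC
    rw [this]
    exact ((isCompact_Icc.inter_right hC).image_of_continuousOn
      (hf.mono Set.inter_subset_left)).isClosed.preimage hγc
  set h : ℝ → ℝ := fun θ => σ (γ θ) - σ (γ (θ + Real.pi)) with hh
  have hhc : Continuous h := hτc.sub (hτc.comp (continuous_id.add continuous_const))
  have hflip : h Real.pi = - h 0 := by
    have : γ (Real.pi + Real.pi) = γ 0 := by simp [hγ, ← two_mul]
    simp [hh, this]
  obtain ⟨θ, hθ⟩ : (0:ℝ) ∈ Set.range h := by
    rcases le_total (h 0) 0 with h0 | h0
    · exact mem_range_of_exists_le_of_exists_ge hhc ⟨0, h0⟩ ⟨Real.pi, by linarith⟩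
    · exact mem_range_of_exists_le_of_exists_ge hhc ⟨Real.pi, by linarith⟩ ⟨0, h0⟩
  have heq : γ θ = γ (θ + Real.pi) := by
    rw [← (hσγ θ).2, ← (hσγ (θ + Real.pi)).2, sub_eq_zero.1 hθ]
  simp only [hγ, Real.cos_add_pi, Real.sin_add_pi, add_right_inj, Prod.mk.injEq] at heq
  have hc : Real.cos θ = 0 := by nlinarith [heq.1]
  have hs : Real.sin θ = 0 := by nlinarith [heq.2]
  simpa [hc, hs] using Real.sin_sq_add_cos_sq θ

theorem LoopHomotopic.symm {V : Set (ℝ × ℝ)} {x : ℝ × ℝ} {f g : ℝ → ℝ × ℝ}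
    (h : LoopHomotopic V x f g) : LoopHomotopic V x g f := by
  obtain ⟨H, hc, h01, hx, hV⟩ := h
  refine ⟨fun s t => H (1 - s) t, ?_, ?_, ?_, ?_⟩
  · refine hc.comp (f := fun p : ℝ × ℝ => (1 - p.1, p.2)) (by fun_prop) ?_
    rintro ⟨s, t⟩ ⟨hs, ht⟩
    exact ⟨⟨sub_nonneg.2 hs.2, by linarith [hs.1]⟩, ht⟩
  · intro t ht
    simpa using (h01 t ht).symm
  · intro s hs
    exact hx _ ⟨sub_nonneg.2 hs.2, by linarith [hs.1]⟩
  · intro s hs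
    exact hV _ ⟨sub_pos.2 hs.2, by linarith [hs.1]⟩

theorem LoopHomotopic.trans {V : Set (ℝ × ℝ)} {x : ℝ × ℝ} {f g h : ℝ → ℝ × ℝ}
    (hg : IsLoop V x g) (hfg : LoopHomotopic V x f g) (hgh : LoopHomotopic V x g h) :
    LoopHomotopic V x f h := by
  obtain ⟨H, hHc, hH01, hHx, hHV⟩ := hfg
  obtain ⟨K, hKc, hK01, hKx, hKV⟩ := hgh
  obtain ⟨G, hleft, hright⟩ : ∃ G : ℝ → ℝ → ℝ × ℝ, (∀ s t, s ≤ 1 / 2 → G s t = H (2 * s) t) ∧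
      ∀ s, ∀ t ∈ Set.Icc (0:ℝ) 1, 1 / 2 ≤ s → G s t = K (2 * s - 1) t := by
    refine ⟨fun s t => if s ≤ 1 / 2 then H (2 * s) t else K (2 * s - 1) t,
      fun s t hs => if_pos hs, fun s t ht hs => ?_⟩
    rcases hs.eq_or_lt with rfl | hs
    · norm_num [(hH01 t ht).2, (hK01 t ht).1]
    · exact if_neg hs.not_ge
  refine ⟨G, ?_, ?_, ?_, ?_⟩
  · have hunion : Set.Icc (0:ℝ) 1 ×ˢ Set.Icc (0:ℝ) 1 =
        Set.Icc (0:ℝ) (1 / 2) ×ˢ Set.Icc (0:ℝ) 1 ∪ Set.Icc (1 / 2 : ℝ) 1 ×ˢ Set.Icc (0:ℝ) 1 := by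
      rw [← Set.union_prod, Set.Icc_union_Icc_eq_Icc (by norm_num) (by norm_num)]
    rw [hunion]
    refine ContinuousOn.union_of_isClosed ?_ ?_ (isClosed_Icc.prod isClosed_Icc)
      (isClosed_Icc.prod isClosed_Icc)
    · refine (hHc.comp (f := fun p : ℝ × ℝ => (2 * p.1, p.2)) (by fun_prop) ?_).congr
        fun p hp => hleft p.1 p.2 hp.1.2
      rintro ⟨s, t⟩ ⟨hs, ht⟩
      exact ⟨⟨by linarith [hs.1], by linarith [hs.2]⟩, ht⟩
    · refine (hKc.comp (f := fun p : ℝ × ℝ => (2 * p.1 - 1, p.2)) (by fun_prop) ?_).congr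
        fun p hp => hright p.1 p.2 hp.2 hp.1.1
      rintro ⟨s, t⟩ ⟨hs, ht⟩
      exact ⟨⟨by linarith [hs.1], by linarith [hs.2]⟩, ht⟩
  · intro t ht
    rw [hleft 0 t (by norm_num), hright 1 t ht (by norm_num)]
    norm_num [(hH01 t ht).1, (hK01 t ht).2]
  · intro s hs
    rcases le_total s (1 / 2) with h2 | h2
    · rw [hleft _ _ h2, hleft _ _ h2]
      exact hHx _ ⟨by linarith [hs.1], by linarith⟩
    · rw [hright s 0 (by simp) h2, hright s 1 (by simp) h2]
      exact hKx _ ⟨by linarith, by linarith [hs.2]⟩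
  · intro s hs t ht
    rcases lt_trichotomy s (1 / 2) with h2 | rfl | h2
    · rw [hleft _ _ h2.le]
      exact hHV _ ⟨by linarith [hs.1], by linarith⟩ _ ht
    · rw [hleft _ _ le_rfl, show (2 * (1 / 2) : ℝ) = 1 by norm_num,
        (hH01 t (Set.Ioo_subset_Icc_self ht)).2]
      exact hg.2.2.2 t ht
    · rw [hright _ _ (Set.Ioo_subset_Icc_self ht) h2.le]
      exact hKV _ ⟨by linarith, by linarith [hs.2]⟩ _ ht

/-- A cut-off function on `[0,1]`, vanishing at the endpoints and equal to `1` on `[a, 1 - a]`. -/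
noncomputable def endCutoff (a t : ℝ) : ℝ := min t (1 - t) / max (min t (1 - t)) a

theorem endCutoff_nonneg {a t : ℝ} (ht : t ∈ Set.Icc (0:ℝ) 1) : 0 ≤ endCutoff a t := by
  have : 0 ≤ min t (1 - t) := le_min ht.1 (sub_nonneg.2 ht.2)
  exact div_nonneg this (this.trans (le_max_left _ _))

theorem endCutoff_pos {a t : ℝ} (ht : t ∈ Set.Ioo (0:ℝ) 1) : 0 < endCutoff a t := by
  have : 0 < min t (1 - t) := lt_min ht.1 (sub_pos.2 ht.2)
  exact div_pos this (this.trans_le (le_max_left _ _))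

theorem endCutoff_le_one {a t : ℝ} (ht : t ∈ Set.Icc (0:ℝ) 1) : endCutoff a t ≤ 1 := by
  have : 0 ≤ min t (1 - t) := le_min ht.1 (sub_nonneg.2 ht.2)
  exact div_le_one_of_le₀ (le_max_left _ _) (this.trans (le_max_left _ _))

theorem endCutoff_eq_one {a t : ℝ} (ht : t ∈ Set.Ioo (0:ℝ) 1) (ha : a ≤ min t (1 - t)) :
    endCutoff a t = 1 := by
  rw [endCutoff, max_eq_left ha, div_self (lt_min ht.1 (sub_pos.2 ht.2)).ne']

@[simp] theorem endCutoff_zero (a : ℝ) : endCutoff a 0 = 0 := by simp [endCutoff]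

@[simp] theorem endCutoff_one (a : ℝ) : endCutoff a 1 = 0 := by simp [endCutoff]

theorem continuous_endCutoff {a : ℝ} (ha : 0 < a) : Continuous (endCutoff a) := by
  unfold endCutoff
  exact Continuous.div (by fun_prop) (by fun_prop) fun t => (lt_max_of_lt_right ha).ne'

/-- The curve obtained from the `v`-loop `f` by replacing its pieces over `[0, a]` and `[1 - a, 1]`
by straight segments. -/
noncomputable def radialEnds (v : ℝ × ℝ) (f : ℝ → ℝ × ℝ) (a t : ℝ) : ℝ × ℝ :=
  v + endCutoff a t • (f (max a (min t (1 - a))) - v)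

theorem radialEnds_eq_self {v : ℝ × ℝ} {f : ℝ → ℝ × ℝ} {a t : ℝ} (ht : t ∈ Set.Ioo (0:ℝ) 1)
    (ha : a ≤ min t (1 - t)) : radialEnds v f a t = f t := by
  have h1 : min t (1 - a) = t := min_eq_left (by linarith [min_le_right t (1 - t)])
  rw [radialEnds, endCutoff_eq_one ht ha, h1, max_eq_right (ha.trans (min_le_left _ _)), one_smul,
    add_sub_cancel]

@[simp] theorem radialEnds_apply_zero (v : ℝ × ℝ) (f : ℝ → ℝ × ℝ) (a : ℝ) :
    radialEnds v f a 0 = v := by simp [radialEnds]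

@[simp] theorem radialEnds_apply_one (v : ℝ × ℝ) (f : ℝ → ℝ × ℝ) (a : ℝ) :
    radialEnds v f a 1 = v := by simp [radialEnds]

theorem radialEnds_congr {v : ℝ × ℝ} {f g : ℝ → ℝ × ℝ} {a : ℝ} (ha : a ≤ 1 / 2)
    (h : ∀ t ∈ Set.Icc a (1 - a), f t = g t) : radialEnds v f a = radialEnds v g a := by
  ext1 t
  rw [radialEnds, radialEnds, h _ ⟨le_max_left _ _, max_le (by linarith) (min_le_right _ _)⟩]

theorem continuousOn_radialEnds {v : ℝ × ℝ} {f : ℝ → ℝ × ℝ} {ε : ℝ} (hf0 : f 0 = v) (hf1 : f 1 = v)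
    (hf : ContinuousOn f (Set.Icc 0 1)) (hε : 0 < ε) (hε' : ε ≤ 1 / 2) :
    ContinuousOn (fun p : ℝ × ℝ => radialEnds v f (p.1 * ε) p.2)
      (Set.Icc 0 1 ×ˢ Set.Icc 0 1) := by
  have ha : ∀ p ∈ Set.Icc (0:ℝ) 1 ×ˢ Set.Icc (0:ℝ) 1, p.1 * ε ∈ Set.Icc (0:ℝ) (1 / 2) := by
    rintro ⟨s, t⟩ ⟨hs, ht⟩
    exact ⟨mul_nonneg hs.1 hε.le, (mul_le_of_le_one_left hε.le hs.2).trans hε'⟩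
  have hF : ContinuousOn (fun p : ℝ × ℝ => f (max (p.1 * ε) (min p.2 (1 - p.1 * ε))) - v)
      (Set.Icc 0 1 ×ˢ Set.Icc 0 1) := by
    refine (hf.comp (f := fun p : ℝ × ℝ => max (p.1 * ε) (min p.2 (1 - p.1 * ε)))
      (by fun_prop) fun p hp => ?_).sub continuousOn_const
    have := ha p hp
    exact ⟨this.1.trans (le_max_left _ _), max_le (by linarith [this.2])
      ((min_le_right _ _).trans (by linarith [this.1]))⟩
  refine continuousOn_const.add fun p hp => ?_
  by_cases hp0 : max (min p.2 (1 - p.2)) (p.1 * ε) = 0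
  · have hm : min p.2 (1 - p.2) ≤ 0 := hp0 ▸ le_max_left _ _
    have hs : p.1 * ε = 0 := le_antisymm (hp0 ▸ le_max_right _ _) (ha p hp).1
    have hend : p.2 = 0 ∨ p.2 = 1 := by
      rcases min_le_iff.1 hm with h | h
      · exact Or.inl (le_antisymm h hp.2.1)
      · exact Or.inr (le_antisymm hp.2.2 (sub_nonpos.1 h))
    have hFp : f (max (p.1 * ε) (min p.2 (1 - p.1 * ε))) - v = 0 := by
      rcases hend with h | h <;> simp [hs, h, hf0, hf1]
    have hlim := (hF p hp).tendsto
    simp only [hFp] at hlim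
    unfold ContinuousWithinAt
    simp only [hFp, smul_zero]
    refine squeeze_zero_norm' ?_ (by simpa using hlim.norm)
    filter_upwards [self_mem_nhdsWithin] with q hq
    rw [norm_smul, Real.norm_of_nonneg (endCutoff_nonneg hq.2)]
    exact mul_le_of_le_one_left (norm_nonneg _) (endCutoff_le_one hq.2)
  · have hcut : ContinuousAt (fun p : ℝ × ℝ => endCutoff (p.1 * ε) p.2) p := by
      unfold endCutoff
      exact ContinuousAt.div (by fun_prop) (by fun_prop) hp0
    exact hcut.continuousWithinAt.smul (hF p hp)

theorem add_smul_sub_mem_ball {v z : ℝ × ℝ} {c R : ℝ} (hc0 : 0 ≤ c) (hc1 : c ≤ 1)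
    (hz : z ∈ Metric.ball v R) : v + c • (z - v) ∈ Metric.ball v R := by
  rw [mem_ball_iff_norm] at hz ⊢
  rw [add_sub_cancel_left, norm_smul, Real.norm_of_nonneg hc0]
  exact (mul_le_of_le_one_left (norm_nonneg _) hc1).trans_lt hz

theorem add_smul_sub_notMem {V : Set (ℝ × ℝ)} {v z : ℝ × ℝ} {c R : ℝ}
    (hR : V ∩ Metric.ball v R ⊆ {v}) (hc0 : 0 < c) (hc1 : c ≤ 1)
    (hz : z ∈ Metric.ball v R) (hzv : z ≠ v) : v + c • (z - v) ∉ V := by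
  intro hmem
  have := hR ⟨hmem, add_smul_sub_mem_ball hc0.le hc1 hz⟩
  rw [Set.mem_singleton_iff, add_eq_left, smul_eq_zero, sub_eq_zero] at this
  exact this.elim hc0.ne' hzv

theorem IsLoop.radialEnds_notMem {V : Set (ℝ × ℝ)} {v : ℝ × ℝ} {f : ℝ → ℝ × ℝ} {ε R a t : ℝ}
    (hv : v ∈ V) (hR : V ∩ Metric.ball v R ⊆ {v}) (hf : IsLoop V v f) (hε : ε ≤ 1 / 2)
    (hend : ∀ t ∈ Set.Icc (0:ℝ) 1, min t (1 - t) ≤ ε → f t ∈ Metric.ball v R)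
    (ha : 0 < a) (haε : a ≤ ε) (ht : t ∈ Set.Ioo (0:ℝ) 1) : radialEnds v f a t ∉ V := by
  rcases le_or_gt a (min t (1 - t)) with hat | hat
  · rw [radialEnds_eq_self ht hat]
    exact hf.2.2.2 t ht
  · set c := max a (min t (1 - a)) with hc
    have hca : c = a ∨ c = 1 - a := by
      rcases min_lt_iff.1 hat with h | h
      · exact Or.inl (max_eq_left ((min_le_left _ _).trans h.le))
      · right
        rw [hc, min_eq_right (by linarith), max_eq_right (by linarith)]
    have hc01 : c ∈ Set.Ioo (0:ℝ) 1 := by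
      rcases hca with h | h <;> rw [h] <;> constructor <;> linarith
    have hcε : min c (1 - c) ≤ ε := by
      rcases hca with h | h
      · exact (min_le_left _ _).trans (h.trans_le haε)
      · exact (min_le_right _ _).trans (by linarith)
    exact add_smul_sub_notMem hR (endCutoff_pos ht) (endCutoff_le_one (Set.Ioo_subset_Icc_self ht))
      (hend c (Set.Ioo_subset_Icc_self hc01) hcε) fun h => hf.2.2.2 c hc01 (h ▸ hv)

theorem IsLoop.isLoop_radialEnds {V : Set (ℝ × ℝ)} {v : ℝ × ℝ} {f : ℝ → ℝ × ℝ} {ε R : ℝ}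
    (hv : v ∈ V) (hR : V ∩ Metric.ball v R ⊆ {v}) (hf : IsLoop V v f) (hε0 : 0 < ε)
    (hε : ε ≤ 1 / 2)
    (hend : ∀ t ∈ Set.Icc (0:ℝ) 1, min t (1 - t) ≤ ε → f t ∈ Metric.ball v R) :
    IsLoop V v (radialEnds v f ε) := by
  refine ⟨?_, by simp, by simp, fun t ht => hf.radialEnds_notMem hv hR hε hend hε0 le_rfl ht⟩
  have := (continuousOn_radialEnds hf.2.1 hf.2.2.1 hf.1 hε0 hε).comp
    (f := fun t : ℝ => ((1 : ℝ), t)) (s := Set.Icc 0 1) (by fun_prop)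
    fun t ht => ⟨by simp, ht⟩
  simpa [Function.comp_def] using this

theorem IsLoop.homotopic_radialEnds {V : Set (ℝ × ℝ)} {v : ℝ × ℝ} {f : ℝ → ℝ × ℝ} {ε R : ℝ}
    (hv : v ∈ V) (hR : V ∩ Metric.ball v R ⊆ {v}) (hf : IsLoop V v f) (hε0 : 0 < ε)
    (hε : ε ≤ 1 / 2)
    (hend : ∀ t ∈ Set.Icc (0:ℝ) 1, min t (1 - t) ≤ ε → f t ∈ Metric.ball v R) :
    LoopHomotopic V v f (radialEnds v f ε) := by
  refine ⟨fun s t => radialEnds v f (s * ε) t,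
    continuousOn_radialEnds hf.2.1 hf.2.2.1 hf.1 hε0 hε, fun t ht => ⟨?_, by simp⟩,
    fun s _ => by simp, fun s hs t ht => ?_⟩
  · rcases ht.1.eq_or_lt with rfl | h0
    · simp [hf.2.1]
    rcases ht.2.eq_or_lt with rfl | h1
    · simp [hf.2.2.1]
    exact radialEnds_eq_self ⟨h0, h1⟩ (by simpa using ht)
  · exact hf.radialEnds_notMem hv hR hε hend (mul_pos hs.1 hε0)
      (mul_le_of_le_one_left hε0.le hs.2.le) ht

/-- Two `v`-loops which agree away from the endpoints and stay near `v` close to the endpoints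
are homotopic. -/
theorem IsLoop.homotopic_of_eqOn {V : Set (ℝ × ℝ)} {v : ℝ × ℝ} {f g : ℝ → ℝ × ℝ} {ε R : ℝ}
    (hv : v ∈ V) (hR : V ∩ Metric.ball v R ⊆ {v}) (hf : IsLoop V v f) (hg : IsLoop V v g)
    (hε0 : 0 < ε) (hε : ε ≤ 1 / 2)
    (hfend : ∀ t ∈ Set.Icc (0:ℝ) 1, min t (1 - t) ≤ ε → f t ∈ Metric.ball v R)
    (hgend : ∀ t ∈ Set.Icc (0:ℝ) 1, min t (1 - t) ≤ ε → g t ∈ Metric.ball v R)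
    (hfg : ∀ t ∈ Set.Icc ε (1 - ε), f t = g t) : LoopHomotopic V v f g := by
  refine LoopHomotopic.trans (hf.isLoop_radialEnds hv hR hε0 hε hfend)
    (hf.homotopic_radialEnds hv hR hε0 hε hfend) ?_
  rw [radialEnds_congr hε hfg]
  exact (hg.homotopic_radialEnds hv hR hε0 hε hgend).symm

/-- The radial push away from `w`, moving the open ball of radius `r` minus its centre `w` to the
bounding sphere and fixing everything outside it. -/
noncomputable def pushAway (w : ℝ × ℝ) (r : ℝ) (z : ℝ × ℝ) : ℝ × ℝ :=
  w + max 1 (r / ‖z - w‖) • (z - w)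

theorem continuousOn_pushAway (w : ℝ × ℝ) (r : ℝ) : ContinuousOn (pushAway w r) {w}ᶜ := by
  unfold pushAway
  have hsub : Continuous fun z : ℝ × ℝ => z - w := by fun_prop
  have hdiv : ContinuousOn (fun z : ℝ × ℝ => r / ‖z - w‖) {w}ᶜ :=
    continuousOn_const.div hsub.norm.continuousOn
      fun z hz => norm_ne_zero_iff.2 (sub_ne_zero.2 hz)
  exact continuousOn_const.add ((continuousOn_const.sup hdiv).smul hsub.continuousOn)

theorem pushAway_of_le {w z : ℝ × ℝ} {r : ℝ} (h : r ≤ ‖z - w‖) : pushAway w r z = z := by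
  rw [pushAway, max_eq_left (div_le_one_of_le₀ h (norm_nonneg _)), one_smul, add_sub_cancel]

theorem norm_pushAway_sub {w z : ℝ × ℝ} {r : ℝ} (hz : z ≠ w) :
    ‖pushAway w r z - w‖ = max ‖z - w‖ r := by
  have hpos : 0 < ‖z - w‖ := norm_pos_iff.2 (sub_ne_zero.2 hz)
  rw [pushAway, add_sub_cancel_left, norm_smul,
    Real.norm_of_nonneg (zero_le_one.trans (le_max_left _ _)), max_mul_of_nonneg _ _ hpos.le,
    one_mul, div_mul_cancel₀ _ hpos.ne']

theorem pushAway_ne {v w z : ℝ × ℝ} {r : ℝ} (hz : z ≠ w) (hv : ‖v - w‖ < r) :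
    pushAway w r z ≠ v := by
  rintro rfl
  rw [norm_pushAway_sub hz] at hv
  exact absurd hv (le_max_right _ _).not_gt

theorem pushAway_mem_ball {v w z : ℝ × ℝ} {r R : ℝ} (hz : z ≠ w) (hv : ‖v - w‖ < r)
    (hR : 2 * r ≤ R) (hzR : z ∈ Metric.ball v R) : pushAway w r z ∈ Metric.ball v R := by
  rcases le_or_gt r ‖z - w‖ with h | h
  · rwa [pushAway_of_le h]
  · rw [mem_ball_iff_norm]
    have h1 := norm_pushAway_sub (r := r) hz
    rw [max_eq_right h.le] at h1
    have h2 : ‖pushAway w r z - v‖ ≤ ‖pushAway w r z - w‖ + ‖v - w‖ := by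
      rw [norm_sub_rev v w]
      exact norm_sub_le_norm_sub_add_norm_sub _ _ _
    linarith

/-- A homotopy of loops at `v` is uniformly close to `v` near the endpoints. -/
theorem exists_mem_ball_of_min_le {v : ℝ × ℝ} {H : ℝ → ℝ → ℝ × ℝ}
    (hc : ContinuousOn (fun p : ℝ × ℝ => H p.1 p.2) (Set.Icc 0 1 ×ˢ Set.Icc 0 1))
    (hv : ∀ s ∈ Set.Icc (0:ℝ) 1, H s 0 = v ∧ H s 1 = v) {R : ℝ} (hR : 0 < R) :
    ∃ δ > 0, ∀ s ∈ Set.Icc (0:ℝ) 1, ∀ t ∈ Set.Icc (0:ℝ) 1, min t (1 - t) ≤ δ →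
      H s t ∈ Metric.ball v R := by
  have huc := (isCompact_Icc.prod isCompact_Icc).uniformContinuousOn_of_continuous hc
  obtain ⟨δ, hδ, h⟩ := Metric.uniformContinuousOn_iff.1 huc R hR
  refine ⟨δ / 2, half_pos hδ, fun s hs t ht hmin => ?_⟩
  rcases min_le_iff.1 hmin with h2 | h2
  · have := h (s, t) ⟨hs, ht⟩ (s, 0) ⟨hs, by simp⟩ (by
      rw [Prod.dist_eq, dist_self, Real.dist_eq, sub_zero, abs_of_nonneg ht.1]
      exact max_lt hδ (by linarith))
    simpa [(hv s hs).1] using this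
  · have := h (s, t) ⟨hs, ht⟩ (s, 1) ⟨hs, by simp⟩ (by
      rw [Prod.dist_eq, dist_self, Real.dist_eq, abs_sub_comm, abs_of_nonneg (sub_nonneg.2 ht.2)]
      exact max_lt hδ (by linarith))
    simpa [(hv s hs).2] using this

/-- Splitting the obstacle `v` into the base point `v` and a nearby obstacle `w` does not make
loops homotopic, provided that the loops stay far from `v` except near their endpoints. -/
theorem LoopHomotopic.of_insert_sdiff {V : Set (ℝ × ℝ)} {v w : ℝ × ℝ} {f g : ℝ → ℝ × ℝ}
    {ε r R : ℝ} (hv : v ∈ V) (hR : V ∩ Metric.ball v R ⊆ {v}) (hw : ‖v - w‖ < r)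
    (hvw : v ≠ w) (hrR : 2 * r ≤ R) (hε0 : 0 < ε) (hε : ε ≤ 1 / 2)
    (hf : IsLoop V v f) (hg : IsLoop V v g)
    (hfw : ∀ t ∈ Set.Icc (0:ℝ) 1, f t ≠ w) (hgw : ∀ t ∈ Set.Icc (0:ℝ) 1, g t ≠ w)
    (hfend : ∀ t ∈ Set.Icc (0:ℝ) 1, min t (1 - t) ≤ ε → f t ∈ Metric.ball v R)
    (hgend : ∀ t ∈ Set.Icc (0:ℝ) 1, min t (1 - t) ≤ ε → g t ∈ Metric.ball v R)
    (hfar : ∀ t ∈ Set.Icc ε (1 - ε), 2 * r ≤ ‖f t - v‖)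
    (hgar : ∀ t ∈ Set.Icc ε (1 - ε), 2 * r ≤ ‖g t - v‖)
    (h : LoopHomotopic (insert w (V \ {v})) v f g) : LoopHomotopic V v f g := by
  obtain ⟨H, hHc, hH01, hHv, hHV⟩ := h
  have hr : 0 < r := (norm_nonneg _).trans_lt hw
  obtain ⟨η, hη, hHη⟩ := exists_mem_ball_of_min_le hHc hHv (show 0 < R by linarith)
  obtain ⟨δ, hδ, hδε, hδη⟩ : ∃ δ > 0, δ ≤ ε ∧ δ ≤ η :=
    ⟨min ε η, lt_min hε0 hη, min_le_left _ _, min_le_right _ _⟩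
  have hHw : ∀ s ∈ Set.Icc (0:ℝ) 1, ∀ t ∈ Set.Icc (0:ℝ) 1, H s t ≠ w := by
    intro s hs t ht
    rcases hs.1.eq_or_lt with rfl | hs0
    · exact (hH01 t ht).1 ▸ hfw t ht
    rcases hs.2.eq_or_lt with rfl | hs1
    · exact (hH01 t ht).2 ▸ hgw t ht
    rcases ht.1.eq_or_lt with rfl | ht0
    · exact (hHv s hs).1 ▸ hvw
    rcases ht.2.eq_or_lt with rfl | ht1
    · exact (hHv s hs).2 ▸ hvw
    exact fun h => hHV s ⟨hs0, hs1⟩ t ⟨ht0, ht1⟩ (h ▸ Set.mem_insert _ _)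
  have hHV' : ∀ s ∈ Set.Icc (0:ℝ) 1, ∀ t ∈ Set.Ioo (0:ℝ) 1, H s t ∈ V → H s t = v := by
    intro s hs t ht hmem
    by_contra hne
    have ht' := Set.Ioo_subset_Icc_self ht
    rcases hs.1.eq_or_lt with rfl | hs0
    · exact hf.2.2.2 t ht ((hH01 t ht').1 ▸ hmem)
    rcases hs.2.eq_or_lt with rfl | hs1
    · exact hg.2.2.2 t ht ((hH01 t ht').2 ▸ hmem)
    exact hHV s ⟨hs0, hs1⟩ t ht (Set.mem_insert_of_mem _ ⟨hmem, hne⟩)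
  set G : ℝ → ℝ → ℝ × ℝ := fun s t => v + endCutoff δ t • (pushAway w r (H s t) - v) with hG
  have hGc : ContinuousOn (fun p : ℝ × ℝ => G p.1 p.2) (Set.Icc 0 1 ×ˢ Set.Icc 0 1) := by
    refine continuousOn_const.add
      (((continuous_endCutoff hδ).comp continuous_snd).continuousOn.smul
        (((continuousOn_pushAway w r).comp hHc ?_).sub continuousOn_const))
    rintro ⟨s, t⟩ ⟨hs, ht⟩
    exact hHw s hs t ht
  have hGV : ∀ s ∈ Set.Icc (0:ℝ) 1, ∀ t ∈ Set.Ioo (0:ℝ) 1, G s t ∉ V := by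
    intro s hs t ht
    have ht' := Set.Ioo_subset_Icc_self ht
    have hne := pushAway_ne (hHw s hs t ht') hw
    have hnear : H s t ∈ Metric.ball v R → G s t ∉ V := fun hb =>
      add_smul_sub_notMem hR (endCutoff_pos ht) (endCutoff_le_one ht')
        (pushAway_mem_ball (hHw s hs t ht') hw hrR hb) hne
    by_cases hb : H s t ∈ Metric.ball v R
    · exact hnear hb
    have hmin : δ ≤ min t (1 - t) := by
      by_contra! hlt
      exact hb (hHη s hs t ht' (hlt.le.trans hδη))
    have hHr : r ≤ ‖H s t - w‖ := by
      rw [mem_ball_iff_norm, not_lt] at hb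
      have := norm_sub_le_norm_sub_add_norm_sub (H s t) w v
      rw [norm_sub_rev w v] at this
      linarith
    simp only [hG, endCutoff_eq_one ht hmin, pushAway_of_le hHr, one_smul, add_sub_cancel]
    intro hmem
    exact hb (hHV' s hs t ht hmem ▸ Metric.mem_ball_self (by linarith))
  have hGloop : ∀ s ∈ Set.Icc (0:ℝ) 1, IsLoop V v (G s) := fun s hs =>
    ⟨hGc.comp (f := fun t : ℝ => (s, t)) (by fun_prop) fun t ht => ⟨hs, ht⟩, by simp [hG],
      by simp [hG], hGV s hs⟩
  have hGhom : LoopHomotopic V v (G 0) (G 1) :=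
    ⟨G, hGc, fun t _ => ⟨rfl, rfl⟩, fun s _ => by simp [hG],
      fun s hs => hGV s (Set.Ioo_subset_Icc_self hs)⟩
  have hend : ∀ s ∈ Set.Icc (0:ℝ) 1, ∀ e : ℝ → ℝ × ℝ, IsLoop V v e →
      (∀ t ∈ Set.Icc (0:ℝ) 1, H s t = e t) →
      (∀ t ∈ Set.Icc (0:ℝ) 1, min t (1 - t) ≤ ε → e t ∈ Metric.ball v R) →
      (∀ t ∈ Set.Icc ε (1 - ε), 2 * r ≤ ‖e t - v‖) → LoopHomotopic V v e (G s) := by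
    intro s hs e he hHe heend hear
    refine he.homotopic_of_eqOn hv hR (hGloop s hs) hε0 hε heend ?_ ?_
    · intro t ht hmin
      exact add_smul_sub_mem_ball (endCutoff_nonneg ht) (endCutoff_le_one ht)
        (pushAway_mem_ball (hHw s hs t ht) hw hrR (hHe t ht ▸ heend t ht hmin))
    · intro t ht
      have htI : t ∈ Set.Ioo (0:ℝ) 1 := ⟨by linarith [ht.1], by linarith [ht.2]⟩
      have hmin : δ ≤ min t (1 - t) :=
        hδε.trans (le_min ht.1 (by linarith [ht.2]))
      have hr' : r ≤ ‖e t - w‖ := by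
        have := norm_sub_le_norm_sub_add_norm_sub (e t) w v
        rw [norm_sub_rev w v] at this
        linarith [hear t ht]
      simp only [hG, endCutoff_eq_one htI hmin, hHe t (Set.Ioo_subset_Icc_self htI),
        pushAway_of_le hr', one_smul, add_sub_cancel]
  have h0 : (0:ℝ) ∈ Set.Icc (0:ℝ) 1 := by simp
  have h1 : (1:ℝ) ∈ Set.Icc (0:ℝ) 1 := by simp
  exact ((hend 0 h0 f hf (fun t ht => (hH01 t ht).1) hfend hfar).trans (hGloop 0 h0) hGhom).trans
    (hGloop 1 h1) (hend 1 h1 g hg (fun t ht => (hH01 t ht).2) hgend hgar).symm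

/-- Scales at which a `v`-loop stays near `v` close to its endpoints, and far from `v` elsewhere. -/
theorem IsLoop.eventually_mem_ball {V : Set (ℝ × ℝ)} {v : ℝ × ℝ} {f : ℝ → ℝ × ℝ} {R : ℝ}
    (hf : IsLoop V v f) (hR : 0 < R) :
    ∀ᶠ ε in nhdsWithin (0:ℝ) (Set.Ioi 0),
      ∀ t ∈ Set.Icc (0:ℝ) 1, min t (1 - t) ≤ ε → f t ∈ Metric.ball v R := by
  obtain ⟨δ, hδ, h⟩ := exists_mem_ball_of_min_le (H := fun _ t => f t) (v := v)
    (hf.1.comp continuousOn_snd fun p hp => hp.2) (fun _ _ => ⟨hf.2.1, hf.2.2.1⟩) hR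
  filter_upwards [Ioo_mem_nhdsGT hδ] with ε hε t ht hmin
  exact h 0 (by simp) t ht (hmin.trans hε.2.le)

theorem IsLoop.eventually_le_norm_sub {V : Set (ℝ × ℝ)} {v : ℝ × ℝ} {f : ℝ → ℝ × ℝ} {ε : ℝ}
    (hv : v ∈ V) (hf : IsLoop V v f) (hε : 0 < ε) :
    ∀ᶠ r in nhdsWithin (0:ℝ) (Set.Ioi 0), ∀ t ∈ Set.Icc ε (1 - ε), 2 * r ≤ ‖f t - v‖ := by
  have hsub : Set.Icc ε (1 - ε) ⊆ Set.Ioo 0 1 := fun t ht =>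
    ⟨hε.trans_le ht.1, by linarith [ht.2]⟩
  have hcont : ContinuousOn (fun t => ‖f t - v‖) (Set.Icc ε (1 - ε)) :=
    ((hf.1.mono (hsub.trans Set.Ioo_subset_Icc_self)).sub continuousOn_const).norm
  have hpos : ∀ t ∈ Set.Icc ε (1 - ε), 0 < ‖f t - v‖ := fun t ht =>
    norm_pos_iff.2 (sub_ne_zero.2 fun h => hf.2.2.2 t (hsub ht) (h ▸ hv))
  obtain ⟨c, hc, hle⟩ := isCompact_Icc.exists_forall_le' hcont hpos
  filter_upwards [Ioo_mem_nhdsGT (half_pos hc)] with r hr t ht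
  linarith [hle t ht, hr.2]

/-- If every finite family of pairwise non-homotopic `x`-loops (base point not an
obstacle, `n` obstacles, fewer than `k` self-intersections per loop and fewer than `k`
pairwise intersections) has at most `M` members, then the same bound holds for finite
families of pairwise non-homotopic `v`-loops (base point an obstacle);
i.e., `g(n,k) ≤ f(n,k)`. -/
theorem g_le_f (n k M : ℕ) (hn : 1 ≤ n) (hk : 1 ≤ k)
    (hf : ∀ V : Set (ℝ × ℝ), V.ncard = n → ∀ x : ℝ × ℝ, x ∉ V →
      ∀ m : ℕ, ∀ L : Fin m → (ℝ → ℝ × ℝ),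
        (∀ i, IsLoop V x (L i)) →
        (∀ i, FewerSelfInterThan k (L i)) →
        (∀ i j, i ≠ j → FewerInterThan k (L i) (L j)) →
        (∀ i j, i ≠ j → ¬ LoopHomotopic V x (L i) (L j)) →
        m ≤ M) :
    ∀ V' : Set (ℝ × ℝ), V'.ncard = n → ∀ v ∈ V',
      ∀ m : ℕ, ∀ L : Fin m → (ℝ → ℝ × ℝ),
        (∀ i, IsLoop V' v (L i)) →
        (∀ i, FewerSelfInterThan k (L i)) →
        (∀ i j, i ≠ j → FewerInterThan k (L i) (L j)) →
        (∀ i j, i ≠ j → ¬ LoopHomotopic V' v (L i) (L j)) →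
        m ≤ M := by
  intro V hV v hv m L hL hself hinter hhom
  have hVfin : V.Finite := Set.finite_of_ncard_pos (by omega)
  obtain ⟨R, hR0, hR⟩ : ∃ R > 0, V ∩ Metric.ball v R ⊆ {v} := by
    have hmem : (V \ {v})ᶜ ∈ nhds v :=
      hVfin.sdiff.isClosed.isOpen_compl.mem_nhds fun h => h.2 rfl
    obtain ⟨R, hR0, hR⟩ := Metric.mem_nhds_iff.1 hmem
    exact ⟨R, hR0, fun z hz => by_contra fun hne => hR hz.2 ⟨hz.1, hne⟩⟩
  obtain ⟨ε, hend, hε0, hε⟩ := ((Filter.eventually_all.2 fun i =>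
    (hL i).eventually_mem_ball hR0).and (Ioc_mem_nhdsGT (half_pos one_pos))).exists
  obtain ⟨r, hfar, hr0, hr⟩ := ((Filter.eventually_all.2 fun i =>
    (hL i).eventually_le_norm_sub hv hε0).and (Ioc_mem_nhdsGT (half_pos hR0))).exists
  have hdense : Dense ((⋂ i, (L i '' Set.Icc 0 1)ᶜ) \ {v}) :=
    (dense_iInter_of_isOpen
      (fun i => (isCompact_Icc.image_of_continuousOn (hL i).1).isClosed.isOpen_compl)
      fun i => dense_compl_image_Icc (hL i).1 (hself i).1).sdiff_singleton v
  obtain ⟨w, ⟨hwL, hwv⟩, hwr⟩ := hdense.exists_mem_open Metric.isOpen_ball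
    ⟨v, Metric.mem_ball_self hr0⟩
  rw [Metric.mem_ball, dist_comm, dist_eq_norm] at hwr
  have hwL' : ∀ i, ∀ t ∈ Set.Icc (0:ℝ) 1, L i t ≠ w := fun i t ht h =>
    Set.mem_iInter.1 hwL i ⟨t, ht, h⟩
  have hvw : v ≠ w := fun h => hwv h.symm
  have hwV : w ∉ V := fun h => hwv (hR ⟨h, by
    rw [Metric.mem_ball, dist_comm, dist_eq_norm]
    linarith⟩)
  refine hf (insert w (V \ {v})) ?_ v ?_ m L ?_ hself hinter ?_
  · rw [Set.ncard_exchange hwV hv, hV]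
  · rintro (h | h)
    · exact hvw h
    · exact h.2 rfl
  · refine fun i => ⟨(hL i).1, (hL i).2.1, (hL i).2.2.1, ?_⟩
    rintro t ht (h | h)
    · exact hwL' i t (Set.Ioo_subset_Icc_self ht) h
    · exact (hL i).2.2.2 t ht h.1
  · exact fun i j hij h => hhom i j hij (h.of_insert_sdiff hv hR hwr hvw (by linarith) hε0 hε
      (hL i) (hL j) (hwL' i) (hwL' j) (hend i) (hend j) (hfar i) (hfar j))
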